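/- Equality of optimal values: there exists an RC-feasible reconstruction if and only if there exists an RC_E-feasible tuple, and in that case the minimum of cost(s*) over all RC-feasible reconstructions s* equals the minimum of the RC_E-objective T_{G₀⁺}(a) + T_{G₁⁺}(b) + T_{G₀⁻}(c) + T_{G₁⁻}(d) over all RC_E-feasible tuples (a, b, c, d). -/

import Mathlib

open Finset

def G0p {N : ℕ} (sh yh : Fin N → Bool) : Finset (Fin N) :=
  univ.filter (fun i => sh i = false ∧ yh i = true)
def G1p {N : ℕ} (sh yh : Fin N → Bool) : Finset (Fin N) :=
  univ.filter (fun i => sh i = true ∧ yh i = true)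
def G0m {N : ℕ} (sh yh : Fin N → Bool) : Finset (Fin N) :=
  univ.filter (fun i => sh i = false ∧ yh i = false)
def G1m {N : ℕ} (sh yh : Fin N → Bool) : Finset (Fin N) :=
  univ.filter (fun i => sh i = true ∧ yh i = false)

/-- a: changes 0→1 among positively-predicted examples -/
def chgA {N : ℕ} (sh yh s : Fin N → Bool) : ℕ :=
  ((G0p sh yh).filter (fun i => s i = true)).card
/-- b: changes 1→0 among positively-predicted examples -/
def chgB {N : ℕ} (sh yh s : Fin N → Bool) : ℕ :=
  ((G1p sh yh).filter (fun i => s i = false)).card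
/-- c: changes 0→1 among negatively-predicted examples -/
def chgC {N : ℕ} (sh yh s : Fin N → Bool) : ℕ :=
  ((G0m sh yh).filter (fun i => s i = true)).card
/-- d: changes 1→0 among negatively-predicted examples -/
def chgD {N : ℕ} (sh yh s : Fin N → Bool) : ℕ :=
  ((G1m sh yh).filter (fun i => s i = false)).card

/-- RC-feasibility: both protected groups nonempty, and the statistical parity
constraint with tolerance ε holds for each group of the reconstruction s. -/
def RCFeasible {N : ℕ} (yh : Fin N → Bool) (ε : ℝ) (s : Fin N → Bool) : Prop :=
  (univ.filter (fun i => s i = true)).Nonempty ∧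
  (univ.filter (fun i => s i = false)).Nonempty ∧
  ∀ g : Bool,
    |((univ.filter (fun i => yh i = true)).card : ℝ) / (N : ℝ) -
      ((univ.filter (fun i => s i = g ∧ yh i = true)).card : ℝ) /
        ((univ.filter (fun i => s i = g)).card : ℝ)| ≤ ε

/-- RC_E-feasibility of a change-count tuple (a,b,c,d). -/
def RCEFeasible (N k n0p n1p n0m n1m : ℕ) (ε : ℝ) (a b c d : ℕ) : Prop :=
  a ≤ n0p ∧ b ≤ n1p ∧ c ≤ n0m ∧ d ≤ n1m ∧
  a + c < n0p + n0m + b + d ∧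
  b + d < n1p + n1m + a + c ∧
  |(k : ℝ) / (N : ℝ) -
    ((n1p : ℝ) - (b : ℝ) + (a : ℝ)) /
      ((n1p : ℝ) + (n1m : ℝ) - (b : ℝ) - (d : ℝ) + (a : ℝ) + (c : ℝ))| ≤ ε ∧
  |(k : ℝ) / (N : ℝ) -
    ((n0p : ℝ) - (a : ℝ) + (b : ℝ)) /
      ((n0p : ℝ) + (n0m : ℝ) - (a : ℝ) - (c : ℝ) + (b : ℝ) + (d : ℝ))| ≤ ε

/-- Cost of a reconstruction: total confidence of changed positions. -/
def cost {N : ℕ} (sh : Fin N → Bool) (p : Fin N → ℝ) (s : Fin N → Bool) : ℝ :=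
  ∑ i ∈ univ.filter (fun i => s i ≠ sh i), p i

/-- T_G(j): the minimum total confidence of a size-j subset of G
(i.e., the sum of the j smallest confidence scores in G). -/
noncomputable def Tmin {N : ℕ} (G : Finset (Fin N)) (p : Fin N → ℝ) (j : ℕ) : ℝ :=
  sInf {x : ℝ | ∃ A : Finset (Fin N), A ⊆ G ∧ A.card = j ∧ x = ∑ i ∈ A, p i}

/-- The RC_E objective at a change-count tuple (a,b,c,d). -/
noncomputable def objE {N : ℕ} (sh yh : Fin N → Bool) (p : Fin N → ℝ)
    (a b c d : ℕ) : ℝ :=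
  Tmin (G0p sh yh) p a + Tmin (G1p sh yh) p b +
    Tmin (G0m sh yh) p c + Tmin (G1m sh yh) p d

theorem card_true_pos_add_chgB {N : ℕ} (sh yh s : Fin N → Bool) :
    (univ.filter (fun i => s i = true ∧ yh i = true)).card + chgB sh yh s =
      (G1p sh yh).card + chgA sh yh s := by
  simp only [chgA, chgB, G0p, G1p, filter_filter, card_filter, ← sum_add_distrib]
  refine sum_congr rfl fun i _ => ?_
  cases sh i <;> cases yh i <;> cases s i <;> simp

theorem card_false_pos_add_chgA {N : ℕ} (sh yh s : Fin N → Bool) :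
    (univ.filter (fun i => s i = false ∧ yh i = true)).card + chgA sh yh s =
      (G0p sh yh).card + chgB sh yh s := by
  simp only [chgA, chgB, G0p, G1p, filter_filter, card_filter, ← sum_add_distrib]
  refine sum_congr rfl fun i _ => ?_
  cases sh i <;> cases yh i <;> cases s i <;> simp

theorem card_true_add_chgB_add_chgD {N : ℕ} (sh yh s : Fin N → Bool) :
    (univ.filter (fun i => s i = true)).card + chgB sh yh s + chgD sh yh s =
      (G1p sh yh).card + (G1m sh yh).card + chgA sh yh s + chgC sh yh s := by
  simp only [chgA, chgB, chgC, chgD, G0p, G1p, G0m, G1m, filter_filter, card_filter,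
    ← sum_add_distrib]
  refine sum_congr rfl fun i _ => ?_
  cases sh i <;> cases yh i <;> cases s i <;> simp

theorem card_false_add_chgA_add_chgC {N : ℕ} (sh yh s : Fin N → Bool) :
    (univ.filter (fun i => s i = false)).card + chgA sh yh s + chgC sh yh s =
      (G0p sh yh).card + (G0m sh yh).card + chgB sh yh s + chgD sh yh s := by
  simp only [chgA, chgB, chgC, chgD, G0p, G1p, G0m, G1m, filter_filter, card_filter,
    ← sum_add_distrib]
  refine sum_congr rfl fun i _ => ?_
  cases sh i <;> cases yh i <;> cases s i <;> simp

theorem cost_eq_sum_groups {N : ℕ} (sh yh s : Fin N → Bool) (p : Fin N → ℝ) :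
    cost sh p s =
      ∑ i ∈ (G0p sh yh).filter (fun i => s i = true), p i +
      ∑ i ∈ (G1p sh yh).filter (fun i => s i = false), p i +
      ∑ i ∈ (G0m sh yh).filter (fun i => s i = true), p i +
      ∑ i ∈ (G1m sh yh).filter (fun i => s i = false), p i := by
  simp only [cost, G0p, G1p, G0m, G1m, filter_filter, sum_filter, ← sum_add_distrib]
  refine sum_congr rfl fun i _ => ?_
  cases sh i <;> cases yh i <;> cases s i <;> simp

theorem cost_nonneg {N : ℕ} (sh s : Fin N → Bool) {p : Fin N → ℝ} (hp : ∀ i, 0 ≤ p i) :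
    0 ≤ cost sh p s :=
  sum_nonneg fun i _ => hp i

/-- RC-feasibility depends only on the change counts. -/
theorem rcFeasible_iff_rceFeasible {N : ℕ} (sh yh s : Fin N → Bool) (ε : ℝ) :
    RCFeasible yh ε s ↔
      RCEFeasible N (univ.filter (fun i => yh i = true)).card
        (G0p sh yh).card (G1p sh yh).card (G0m sh yh).card (G1m sh yh).card ε
        (chgA sh yh s) (chgB sh yh s) (chgC sh yh s) (chgD sh yh s) := by
  have h₁ := card_true_pos_add_chgB sh yh s
  have h₂ := card_false_pos_add_chgA sh yh s
  have h₃ := card_true_add_chgB_add_chgD sh yh s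
  have h₄ := card_false_add_chgA_add_chgC sh yh s
  have ha : chgA sh yh s ≤ (G0p sh yh).card := card_filter_le _ _
  have hb : chgB sh yh s ≤ (G1p sh yh).card := card_filter_le _ _
  have hc : chgC sh yh s ≤ (G0m sh yh).card := card_filter_le _ _
  have hd : chgD sh yh s ≤ (G1m sh yh).card := card_filter_le _ _
  have e₁ : ((univ.filter (fun i => s i = true ∧ yh i = true)).card : ℝ) =
      (G1p sh yh).card - chgB sh yh s + chgA sh yh s := by
    have := congrArg (Nat.cast (R := ℝ)) h₁
    push_cast at this
    linarith
  have e₂ : ((univ.filter (fun i => s i = false ∧ yh i = true)).card : ℝ) =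
      (G0p sh yh).card - chgA sh yh s + chgB sh yh s := by
    have := congrArg (Nat.cast (R := ℝ)) h₂
    push_cast at this
    linarith
  have e₃ : ((univ.filter (fun i => s i = true)).card : ℝ) =
      (G1p sh yh).card + (G1m sh yh).card - chgB sh yh s - chgD sh yh s +
        chgA sh yh s + chgC sh yh s := by
    have := congrArg (Nat.cast (R := ℝ)) h₃
    push_cast at this
    linarith
  have e₄ : ((univ.filter (fun i => s i = false)).card : ℝ) =
      (G0p sh yh).card + (G0m sh yh).card - chgA sh yh s - chgC sh yh s +
        chgB sh yh s + chgD sh yh s := by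
    have := congrArg (Nat.cast (R := ℝ)) h₄
    push_cast at this
    linarith
  rw [RCFeasible, RCEFeasible, Bool.forall_bool, e₁, e₂, e₃, e₄, ← card_pos, ← card_pos]
  constructor
  · rintro ⟨ht, hf, hF, hT⟩
    exact ⟨ha, hb, hc, hd, by omega, by omega, hT, hF⟩
  · rintro ⟨-, -, -, -, hf, ht, hT, hF⟩
    exact ⟨by omega, by omega, hF, hT⟩

theorem Tmin_nonneg {N : ℕ} (G : Finset (Fin N)) {p : Fin N → ℝ} (hp : ∀ i, 0 ≤ p i) (j : ℕ) :
    0 ≤ Tmin G p j := by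
  refine Real.sInf_nonneg ?_
  rintro x ⟨A, -, -, rfl⟩
  exact sum_nonneg fun i _ => hp i

theorem Tmin_card_le_sum {N : ℕ} {G A : Finset (Fin N)} {p : Fin N → ℝ} (hp : ∀ i, 0 ≤ p i)
    (hA : A ⊆ G) : Tmin G p A.card ≤ ∑ i ∈ A, p i := by
  refine csInf_le ⟨0, ?_⟩ ⟨A, hA, rfl, rfl⟩
  rintro x ⟨B, -, -, rfl⟩
  exact sum_nonneg fun i _ => hp i

theorem exists_sum_eq_Tmin {N : ℕ} {G : Finset (Fin N)} (p : Fin N → ℝ) {j : ℕ}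
    (hj : j ≤ G.card) : ∃ A ⊆ G, A.card = j ∧ ∑ i ∈ A, p i = Tmin G p j := by
  obtain ⟨A, hA, hmin⟩ := exists_min_image (powersetCard j G) (fun A => ∑ i ∈ A, p i)
    (powersetCard_nonempty.2 hj)
  obtain ⟨hAG, hAj⟩ := mem_powersetCard.1 hA
  refine ⟨A, hAG, hAj, Eq.symm ?_⟩
  refine IsLeast.csInf_eq ⟨⟨A, hAG, hAj, rfl⟩, ?_⟩
  rintro x ⟨B, hBG, hBj, rfl⟩
  exact hmin B (mem_powersetCard.2 ⟨hBG, hBj⟩)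

theorem objE_nonneg {N : ℕ} (sh yh : Fin N → Bool) {p : Fin N → ℝ} (hp : ∀ i, 0 ≤ p i)
    (a b c d : ℕ) : 0 ≤ objE sh yh p a b c d :=
  add_nonneg (add_nonneg (add_nonneg (Tmin_nonneg _ hp a) (Tmin_nonneg _ hp b))
    (Tmin_nonneg _ hp c)) (Tmin_nonneg _ hp d)

theorem objE_chg_le_cost {N : ℕ} (sh yh s : Fin N → Bool) {p : Fin N → ℝ}
    (hp : ∀ i, 0 ≤ p i) :
    objE sh yh p (chgA sh yh s) (chgB sh yh s) (chgC sh yh s) (chgD sh yh s) ≤ cost sh p s := by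
  rw [cost_eq_sum_groups sh yh]
  exact add_le_add (add_le_add (add_le_add
    (Tmin_card_le_sum hp (filter_subset _ _)) (Tmin_card_le_sum hp (filter_subset _ _)))
    (Tmin_card_le_sum hp (filter_subset _ _))) (Tmin_card_le_sum hp (filter_subset _ _))

/-- Any choice of subsets of the four groups is the set of changes of some reconstruction. -/
theorem exists_filter_groups_eq {N : ℕ} {sh yh : Fin N → Bool} {A B C D : Finset (Fin N)}
    (hA : A ⊆ G0p sh yh) (hB : B ⊆ G1p sh yh) (hC : C ⊆ G0m sh yh) (hD : D ⊆ G1m sh yh) :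
    ∃ s : Fin N → Bool,
      (G0p sh yh).filter (fun i => s i = true) = A ∧
      (G1p sh yh).filter (fun i => s i = false) = B ∧
      (G0m sh yh).filter (fun i => s i = true) = C ∧
      (G1m sh yh).filter (fun i => s i = false) = D := by
  refine ⟨fun i => xor (sh i) (decide (i ∈ A ∨ i ∈ B ∨ i ∈ C ∨ i ∈ D)), ?_, ?_, ?_, ?_⟩ <;>
  · ext i
    have hA := @hA i
    have hB := @hB i
    have hC := @hC i
    have hD := @hD i
    simp only [G0p, G1p, G0m, G1m, mem_filter, mem_univ, true_and] at hA hB hC hD ⊢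
    cases hs : sh i <;> cases hy : yh i <;> simp_all

/-- The objective of a tuple within the group sizes is the cost of a reconstruction with these
change counts. -/
theorem exists_chg_eq_and_cost_eq_objE {N : ℕ} (sh yh : Fin N → Bool) (p : Fin N → ℝ)
    {a b c d : ℕ} (ha : a ≤ (G0p sh yh).card) (hb : b ≤ (G1p sh yh).card)
    (hc : c ≤ (G0m sh yh).card) (hd : d ≤ (G1m sh yh).card) :
    ∃ s : Fin N → Bool, chgA sh yh s = a ∧ chgB sh yh s = b ∧ chgC sh yh s = c ∧
      chgD sh yh s = d ∧ cost sh p s = objE sh yh p a b c d := by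
  obtain ⟨A, hA, hAa, hAT⟩ := exists_sum_eq_Tmin p ha
  obtain ⟨B, hB, hBb, hBT⟩ := exists_sum_eq_Tmin p hb
  obtain ⟨C, hC, hCc, hCT⟩ := exists_sum_eq_Tmin p hc
  obtain ⟨D, hD, hDd, hDT⟩ := exists_sum_eq_Tmin p hd
  obtain ⟨s, sA, sB, sC, sD⟩ := exists_filter_groups_eq hA hB hC hD
  refine ⟨s, ?_, ?_, ?_, ?_, ?_⟩
  · rw [chgA, sA, hAa]
  · rw [chgB, sB, hBb]
  · rw [chgC, sC, hCc]
  · rw [chgD, sD, hDd]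
  · rw [cost_eq_sum_groups sh yh, sA, sB, sC, sD, hAT, hBT, hCT, hDT, objE]

theorem rc_rce_same_optimal_value (N : ℕ) (hN : 1 ≤ N)
    (sh yh : Fin N → Bool) (p : Fin N → ℝ) (hp : ∀ i, 0 ≤ p i)
    (ε : ℝ) (hε : 0 ≤ ε) :
    ((∃ s : Fin N → Bool, RCFeasible yh ε s) ↔
      (∃ a b c d : ℕ,
        RCEFeasible N (univ.filter (fun i => yh i = true)).card
          (G0p sh yh).card (G1p sh yh).card (G0m sh yh).card (G1m sh yh).card ε
          a b c d)) ∧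
    ((∃ s : Fin N → Bool, RCFeasible yh ε s) →
      sInf {x : ℝ | ∃ s : Fin N → Bool, RCFeasible yh ε s ∧ x = cost sh p s} =
        sInf {x : ℝ | ∃ a b c d : ℕ,
          RCEFeasible N (univ.filter (fun i => yh i = true)).card
            (G0p sh yh).card (G1p sh yh).card (G0m sh yh).card (G1m sh yh).card ε
            a b c d ∧
          x = objE sh yh p a b c d}) := by
  have lift : ∀ a b c d : ℕ,
      RCEFeasible N (univ.filter (fun i => yh i = true)).card
        (G0p sh yh).card (G1p sh yh).card (G0m sh yh).card (G1m sh yh).card ε a b c d →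
      ∃ s : Fin N → Bool, RCFeasible yh ε s ∧ objE sh yh p a b c d = cost sh p s := by
    intro a b c d h
    obtain ⟨s, rfl, rfl, rfl, rfl, hs⟩ :=
      exists_chg_eq_and_cost_eq_objE sh yh p h.1 h.2.1 h.2.2.1 h.2.2.2.1
    exact ⟨s, (rcFeasible_iff_rceFeasible sh yh s ε).2 h, hs.symm⟩
  refine ⟨⟨?_, ?_⟩, ?_⟩
  · rintro ⟨s, hs⟩
    exact ⟨_, _, _, _, (rcFeasible_iff_rceFeasible sh yh s ε).1 hs⟩
  · rintro ⟨a, b, c, d, h⟩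
    obtain ⟨s, hs, -⟩ := lift a b c d h
    exact ⟨s, hs⟩
  · rintro ⟨s₀, hs₀⟩
    apply le_antisymm
    · refine csInf_le_csInf ⟨0, ?_⟩
        ⟨_, _, _, _, _, (rcFeasible_iff_rceFeasible sh yh s₀ ε).1 hs₀, rfl⟩ ?_
      · rintro x ⟨s, -, rfl⟩
        exact cost_nonneg sh s hp
      · rintro x ⟨a, b, c, d, h, rfl⟩
        exact lift a b c d h
    · refine le_csInf ⟨_, s₀, hs₀, rfl⟩ ?_
      rintro x ⟨s, hs, rfl⟩
      refine le_trans (csInf_le ⟨0, ?_⟩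
        ⟨_, _, _, _, (rcFeasible_iff_rceFeasible sh yh s ε).1 hs, rfl⟩)
        (objE_chg_le_cost sh yh s hp)
      rintro x ⟨a, b, c, d, -, rfl⟩
      exact objE_nonneg sh yh hp a b c d
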